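/- Let 1 ≤ k ≤ 5 and n ≥ 0 with n + 4 ≤ g. Let x be a primitive vector with x ∈ H_k but x ∉ H_{k+1} ∪ {a_1,a_2,a_3,a_4}, and let x′ be a primitive vector in H_k ∪ {a_1,a_2,a_3,a_4} with ω(x,x′) = 0 and gcd(x,x′) = 1. Let B be a ℚ-basis of the orthogonal complement {z ∈ ℚ^{2g} : ω(z,x) = ω(z,x′) = 0} such that a_1, b_1, …, a_{k−1}, b_{k−1} ∈ B and every element of B either equals some b_j with 1 ≤ j ≤ k−1 or is a primitive integer vector lying in H_k ∪ {a_1,a_2,a_3,a_4}; let z_1, …, z_n be distinct elements of B. Consider the graph whose vertices are the primitive vectors w ∈ H_{k+1} ∪ {a_1,a_2,a_3,a_4} satisfying ω(w,z_i) = 0 for all 1 ≤ i ≤ n, ω(x,w) = 0, and gcd(x,w) = 1, and whose edges join two vertices w, w′ whenever the triple (x,w,w′) is pairwise ω-orthogonal with gcd(x,w,w′) = 1. Then this graph is connected: any two of its vertices are joined by a finite path of edges. -/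

import Mathlib

namespace Paper

/-- The standard symplectic form on `R^{2g}` with respect to the basis
`a_1, b_1, …, a_g, b_g` (coordinates `2i, 2i+1` for `a_{i+1}, b_{i+1}`). -/
def symp {R : Type*} [CommRing R] {g : ℕ} (x y : Fin (2 * g) → R) : R :=
  ∑ i : Fin g,
    (x ⟨2 * i.1, by omega⟩ * y ⟨2 * i.1 + 1, by omega⟩ -
      x ⟨2 * i.1 + 1, by omega⟩ * y ⟨2 * i.1, by omega⟩)

theorem symp_add_left {R : Type*} [CommRing R] {g : ℕ} (x y a : Fin (2 * g) → R) :
    symp (x + y) a = symp x a + symp y a := by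
  unfold symp
  rw [← Finset.sum_add_distrib]
  exact Finset.sum_congr rfl fun i _ => by simp only [Pi.add_apply]; ring

theorem symp_smul_left {R : Type*} [CommRing R] {g : ℕ} (c : R) (x a : Fin (2 * g) → R) :
    symp (c • x) a = c * symp x a := by
  unfold symp
  rw [Finset.mul_sum]
  exact Finset.sum_congr rfl fun i _ => by simp only [Pi.smul_apply, smul_eq_mul]; ring

theorem symp_zero_left {R : Type*} [CommRing R] {g : ℕ} (a : Fin (2 * g) → R) :
    symp (0 : Fin (2 * g) → R) a = 0 := by
  unfold symp; simp

/-- The orthogonal complement `A^⊥ = {x | ω(x,a) = 0 for all a ∈ A}`. -/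
def perp {R : Type*} [CommRing R] {g : ℕ} (A : Set (Fin (2 * g) → R)) :
    Submodule R (Fin (2 * g) → R) where
  carrier := {x | ∀ a ∈ A, symp x a = 0}
  add_mem' := by
    intro x y hx hy a ha
    rw [symp_add_left, hx a ha, hy a ha, add_zero]
  zero_mem' := by
    intro a ha
    exact symp_zero_left a
  smul_mem' := by
    intro c x hx a ha
    rw [symp_smul_left, hx a ha, mul_zero]

/-- The submodule of vectors whose first `m` coordinates vanish.
`H_k = coordZero R (2*g) (2*(k-1))`, and `H₂ = coordZero R (2*(g+1)) 2`. -/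
def coordZero (R : Type*) [CommRing R] (n m : ℕ) : Submodule R (Fin n → R) where
  carrier := {v | ∀ j : Fin n, (j : ℕ) < m → v j = 0}
  add_mem' := by
    intro x y hx hy j hj
    have h1 := hx j hj
    have h2 := hy j hj
    simp [Pi.add_apply, h1, h2]
  zero_mem' := by intro j hj; rfl
  smul_mem' := by
    intro c x hx j hj
    have h1 := hx j hj
    simp [Pi.smul_apply, h1]

/-- The standard basis vector `a_{i+1}` (`i` is 0-indexed). -/
def stdA (R : Type*) [CommRing R] (g i : ℕ) : Fin (2 * g) → R :=
  fun j => if (j : ℕ) = 2 * i then 1 else 0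

/-- The standard basis vector `b_{i+1}` (`i` is 0-indexed). -/
def stdB (R : Type*) [CommRing R] (g i : ℕ) : Fin (2 * g) → R :=
  fun j => if (j : ℕ) = 2 * i + 1 then 1 else 0

/-- Regard an integer vector as a rational vector. -/
def qcast {n : ℕ} (v : Fin n → ℤ) : Fin n → ℚ := fun j => (v j : ℚ)

/-- The projection `pr₂` deleting the `a_1`- and `b_1`-coordinates. -/
def pr2 {R : Type*} [CommRing R] {n : ℕ} (v : Fin n → R) : Fin n → R :=
  fun j => if (j : ℕ) < 2 then 0 else v j

/-- `gcd(v_1, …, v_m) = 1`: the vectors are linearly independent and their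
ℤ-span is a direct summand. -/
def IsUnimodular {n m : ℕ} (v : Fin m → Fin n → ℤ) : Prop :=
  LinearIndependent ℤ v ∧
    ∃ C : Submodule ℤ (Fin n → ℤ), IsCompl (Submodule.span ℤ (Set.range v)) C

/-- A primitive vector. -/
def Primitive {n : ℕ} (v : Fin n → ℤ) : Prop := IsUnimodular ![v]

/-- The entries of `w` are pairwise `ω`-orthogonal. -/
def PairwiseOrth {g m : ℕ} (w : Fin m → Fin (2 * g) → ℤ) : Prop :=
  ∀ i j, i ≠ j → symp (w i) (w j) = 0

/-- `Λ³ W`: the span of all wedges of three vectors from `W` inside the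
exterior algebra. -/
def wedge3 {g : ℕ} (W : Submodule ℚ (Fin (2 * g) → ℚ)) :
    Submodule ℚ (ExteriorAlgebra ℚ (Fin (2 * g) → ℚ)) :=
  Submodule.span ℚ {x | ∃ z₁ ∈ W, ∃ z₂ ∈ W, ∃ z₃ ∈ W,
    x = ExteriorAlgebra.ι ℚ z₁ * ExteriorAlgebra.ι ℚ z₂ * ExteriorAlgebra.ι ℚ z₃}

/-- `u ∧ Λ² W`. -/
def uWedge2 {g : ℕ} (u : Fin (2 * g) → ℚ) (W : Submodule ℚ (Fin (2 * g) → ℚ)) :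
    Submodule ℚ (ExteriorAlgebra ℚ (Fin (2 * g) → ℚ)) :=
  Submodule.span ℚ {x | ∃ z₁ ∈ W, ∃ z₂ ∈ W,
    x = ExteriorAlgebra.ι ℚ u * ExteriorAlgebra.ι ℚ z₁ * ExteriorAlgebra.ι ℚ z₂}

/-- `u ∧ u' ∧ W`. -/
def uuWedge1 {g : ℕ} (u u' : Fin (2 * g) → ℚ) (W : Submodule ℚ (Fin (2 * g) → ℚ)) :
    Submodule ℚ (ExteriorAlgebra ℚ (Fin (2 * g) → ℚ)) :=
  Submodule.span ℚ {x | ∃ z ∈ W,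
    x = ExteriorAlgebra.ι ℚ u * ExteriorAlgebra.ι ℚ u' * ExteriorAlgebra.ι ℚ z}

/-- The simplicial differential: on the summand indexed by `w` it sends `z` to
`Σ_j (-1)^j · z` placed in the summand indexed by `∂_j w`. -/
noncomputable def diff (g p : ℕ)
    (ξ : (Fin (p + 1) → Fin (2 * g) → ℤ) →₀ ExteriorAlgebra ℚ (Fin (2 * g) → ℚ)) :
    (Fin p → Fin (2 * g) → ℤ) →₀ ExteriorAlgebra ℚ (Fin (2 * g) → ℚ) :=
  ξ.sum fun w z =>
    ∑ j : Fin (p + 1), ((-1 : ℚ) ^ (j : ℕ)) • Finsupp.single (fun i => w (j.succAbove i)) z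

/-- The gcd of the determinants of all maximal square submatrices of the matrix
whose columns are the `v i`. -/
def vgcd {ι : Type*} [Fintype ι] {m : ℕ} (v : Fin m → ι → ℤ) : ℕ :=
  Finset.univ.gcd fun r : Fin m → ι => (Matrix.det (Matrix.of fun i j => v j (r i))).natAbs

section

open Module Submodule

/-- An integer divisible by every prime vanishes. -/
theorem eq_zero_of_forall_prime_dvd {c : ℤ} (h : ∀ p : ℕ, p.Prime → (p : ℤ) ∣ c) : c = 0 := by
  obtain ⟨p, hp, hpp⟩ := Nat.exists_infinite_primes (c.natAbs + 1)
  exact Int.eq_zero_of_dvd_of_natAbs_lt_natAbs (h p hpp) (by simpa using hp)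

/-- A tuple is unimodular iff it is linearly independent modulo every prime. -/
theorem isUnimodular_iff {n m : ℕ} (v : Fin m → Fin n → ℤ) :
    IsUnimodular v ↔ ∀ p : ℕ, p.Prime → ∀ (c : Fin m → ℤ) (u : Fin n → ℤ),
      ∑ i, c i • v i = (p : ℤ) • u → ∀ i, (p : ℤ) ∣ c i := by
  constructor
  · rintro ⟨hli, C, hC⟩ p hp c u hu i
    have hmem : ∑ i, c i • v i ∈ Submodule.span ℤ (Set.range v) :=
      Submodule.sum_mem _ fun i _ => Submodule.smul_mem _ _ (Submodule.subset_span ⟨i, rfl⟩)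
    obtain ⟨s, hs, t, ht, rfl⟩ := Submodule.mem_sup.1
      (show u ∈ Submodule.span ℤ (Set.range v) ⊔ C by rw [hC.sup_eq_top]; trivial)
    have ht0 : (p : ℤ) • t = 0 := by
      refine (Submodule.disjoint_def.1 hC.disjoint) _ ?_ (C.smul_mem _ ht)
      have : (p : ℤ) • t = ∑ i, c i • v i - (p : ℤ) • s := by rw [hu, smul_add]; abel
      rw [this]
      exact Submodule.sub_mem _ hmem (Submodule.smul_mem _ _ hs)
    obtain ⟨e, rfl⟩ := (Submodule.mem_span_range_iff_exists_fun ℤ).1 hs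
    rw [smul_add, ht0, add_zero, Finset.smul_sum] at hu
    have := Fintype.linearIndependent_iff.1 hli (fun i => c i - p * e i) (by
      simp only [sub_smul, Finset.sum_sub_distrib, hu, mul_smul, sub_self]) i
    exact ⟨e i, by linarith⟩
  · intro h
    refine ⟨Fintype.linearIndependent_iff.2 fun c hc i =>
      eq_zero_of_forall_prime_dvd fun p hp => h p hp c 0 (by simpa using hc) i, ?_⟩
    set S := Submodule.span ℤ (Set.range v) with hS
    have hsat : ∀ k : ℕ, k ≠ 0 → ∀ u, (k : ℤ) • u ∈ S → u ∈ S := by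
      intro k
      induction k using Nat.recOnMul with
      | zero => simp
      | one => simp
      | prime p hp =>
        intro _ u hu
        obtain ⟨c, hc⟩ := (Submodule.mem_span_range_iff_exists_fun ℤ).1 hu
        choose e he using h p hp c u hc
        have : (p : ℤ) • u = (p : ℤ) • ∑ i, e i • v i := by
          rw [← hc, Finset.smul_sum]
          exact Finset.sum_congr rfl fun i _ => by rw [he i, mul_smul]
        rw [smul_right_injective _ (by exact_mod_cast hp.ne_zero : (p : ℤ) ≠ 0) this]
        exact Submodule.sum_mem _ fun i _ => Submodule.smul_mem _ _ (Submodule.subset_span ⟨i, rfl⟩)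
      | mul a b ha hb =>
        intro hab u hu
        refine hb (by rintro rfl; simp at hab) u (ha (by rintro rfl; simp at hab) _ ?_)
        rwa [smul_smul, ← Nat.cast_mul]
    have : Module.IsTorsionFree ℤ ((Fin n → ℤ) ⧸ S) := by
      refine .of_smul_eq_zero fun k u hku => ?_
      obtain ⟨u, rfl⟩ := S.mkQ_surjective u
      rw [or_iff_not_imp_left]
      intro hk
      rw [← map_smul] at hku
      simp only [Submodule.mkQ_apply, Submodule.Quotient.mk_eq_zero] at hku ⊢
      refine hsat k.natAbs (by simpa using hk) u ?_
      rcases Int.natAbs_eq k with h | h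
      · rwa [← h]
      · rw [show ((k.natAbs : ℕ) : ℤ) = -k by omega, neg_smul]
        exact S.neg_mem hku
    have : Module.Free ℤ ((Fin n → ℤ) ⧸ S) := inferInstance
    obtain ⟨f, hf⟩ := Module.projective_lifting_property S.mkQ LinearMap.id S.mkQ_surjective
    refine ⟨LinearMap.range f, ?_⟩
    have hfm : ∀ t, S.mkQ (f t) = t := fun t => LinearMap.congr_fun hf t
    refine ⟨Submodule.disjoint_def.2 ?_, Submodule.codisjoint_iff_exists_add_eq.2 fun u => ?_⟩
    · rintro _ hs ⟨t, rfl⟩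
      rw [← Submodule.Quotient.mk_eq_zero, ← Submodule.mkQ_apply, hfm] at hs
      rw [hs, map_zero]
    · refine ⟨u - f (S.mkQ u), f (S.mkQ u), ?_, ⟨_, rfl⟩, sub_add_cancel _ _⟩
      rw [← Submodule.Quotient.mk_eq_zero, ← Submodule.mkQ_apply, map_sub, hfm, sub_self]

theorem isUnimodular_two_iff {n : ℕ} (a b : Fin n → ℤ) :
    IsUnimodular ![a, b] ↔ ∀ p : ℕ, p.Prime → ∀ (r s : ℤ) (u : Fin n → ℤ),
      r • a + s • b = (p : ℤ) • u → (p : ℤ) ∣ r ∧ (p : ℤ) ∣ s := by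
  rw [isUnimodular_iff]
  refine forall₂_congr fun p _ => ⟨fun h r s u hu => ?_, fun h c u hu => ?_⟩
  · have := h ![r, s] u (by simpa [Fin.sum_univ_succ] using hu)
    exact ⟨this 0, this 1⟩
  · have := h (c 0) (c 1) u (by simpa [Fin.sum_univ_succ] using hu)
    simpa [Fin.forall_fin_two] using this

theorem isUnimodular_one_iff {n : ℕ} (a : Fin n → ℤ) :
    IsUnimodular ![a] ↔ ∀ p : ℕ, p.Prime → ∀ (r : ℤ) (u : Fin n → ℤ),
      r • a = (p : ℤ) • u → (p : ℤ) ∣ r := by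
  rw [isUnimodular_iff]
  refine forall₂_congr fun p _ => ⟨fun h r u hu => ?_, fun h c u hu => ?_⟩
  · exact h ![r] u (by simpa using hu) 0
  · simpa using h (c 0) u (by simpa using hu)

theorem isUnimodular_three_iff {n : ℕ} (a b c : Fin n → ℤ) :
    IsUnimodular ![a, b, c] ↔ ∀ p : ℕ, p.Prime → ∀ (r s t : ℤ) (u : Fin n → ℤ),
      r • a + s • b + t • c = (p : ℤ) • u → (p : ℤ) ∣ r ∧ (p : ℤ) ∣ s ∧ (p : ℤ) ∣ t := by
  rw [isUnimodular_iff]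
  refine forall₂_congr fun p _ => ⟨fun h r s t u hu => ?_, fun h c u hu => ?_⟩
  · have := h ![r, s, t] u (by simpa [Fin.sum_univ_succ, add_assoc] using hu)
    exact ⟨this 0, this 1, this 2⟩
  · have := h (c 0) (c 1) (c 2) u (by simpa [Fin.sum_univ_succ, add_assoc] using hu)
    simpa [Fin.forall_fin_succ] using this

/-- The vectors congruent modulo `p` to an element of the span of `S`. -/
def modSpan {N : ℕ} (p : ℤ) (S : Set (Fin N → ℤ)) : Submodule ℤ (Fin N → ℤ) :=
  span ℤ S ⊔ LinearMap.range (LinearMap.lsmul ℤ (Fin N → ℤ) p)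

theorem smul_mem_modSpan {N : ℕ} (p : ℤ) (S : Set (Fin N → ℤ)) (u : Fin N → ℤ) :
    p • u ∈ modSpan p S :=
  mem_sup_right ⟨u, rfl⟩

theorem modSpan_mono {N : ℕ} (p : ℤ) {S T : Set (Fin N → ℤ)} (h : S ⊆ T) :
    modSpan p S ≤ modSpan p T :=
  sup_le_sup_right (span_mono h) _

theorem mem_modSpan_singleton {N : ℕ} {p : ℤ} {w v : Fin N → ℤ} :
    v ∈ modSpan p {w} ↔ ∃ (c : ℤ) (u : Fin N → ℤ), v = c • w + p • u := by
  simp only [modSpan, mem_sup, mem_span_singleton, LinearMap.mem_range, LinearMap.lsmul_apply]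
  constructor
  · rintro ⟨_, ⟨c, rfl⟩, _, ⟨u, rfl⟩, rfl⟩; exact ⟨c, u, rfl⟩
  · rintro ⟨c, u, rfl⟩; exact ⟨_, ⟨c, rfl⟩, _, ⟨u, rfl⟩, rfl⟩

theorem mem_modSpan_pair {N : ℕ} {p : ℤ} {w x v : Fin N → ℤ} :
    v ∈ modSpan p {w, x} ↔ ∃ (c e : ℤ) (u : Fin N → ℤ), v = c • w + e • x + p • u := by
  simp only [modSpan, mem_sup, mem_span_pair, LinearMap.mem_range, LinearMap.lsmul_apply]
  constructor
  · rintro ⟨_, ⟨c, e, rfl⟩, _, ⟨u, rfl⟩, rfl⟩; exact ⟨c, e, u, rfl⟩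
  · rintro ⟨c, e, u, rfl⟩; exact ⟨_, ⟨c, e, rfl⟩, _, ⟨u, rfl⟩, rfl⟩

/-- A saturated sublattice is not contained, modulo a prime, in the span of fewer vectors than
its rank. -/
theorem not_le_modSpan {N : ℕ} {L : Submodule ℤ (Fin N → ℤ)}
    (hsat : ∀ (c : ℤ) (v : Fin N → ℤ), c ≠ 0 → c • v ∈ L → v ∈ L)
    (S : Finset (Fin N → ℤ)) (hS : S.card < finrank ℤ L) {p : ℕ} (hp : p.Prime) :
    ¬ L ≤ modSpan p S := by
  intro hle
  have : Fact p.Prime := ⟨hp⟩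
  classical
  let red : (Fin N → ℤ) →+ (Fin N → ZMod p) := (Int.castAddHom (ZMod p)).compLeft (Fin N)
  have hred : ∀ v j, red v j = (v j : ZMod p) := fun _ _ => rfl
  have hsmul : ∀ (c : ℤ) v, red (c • v) = (c : ZMod p) • red v := by
    intro c v; ext j; simp [hred]
  let b := finBasis ℤ L
  have hli : LinearIndependent (ZMod p) fun i => red (b i) := by
    rw [Fintype.linearIndependent_iff]
    intro c hc i
    choose e he using fun i => ZMod.intCast_surjective (c i)
    have h0 : red (∑ i, e i • (b i : Fin N → ℤ)) = 0 := by
      rw [map_sum, ← hc]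
      exact Finset.sum_congr rfl fun i _ => by rw [hsmul, he]
    have hdvd : ∀ j, (p : ℤ) ∣ (∑ i, e i • (b i : Fin N → ℤ)) j := fun j =>
      (ZMod.intCast_zmod_eq_zero_iff_dvd _ p).1 (by rw [← hred, h0]; rfl)
    choose u hu using hdvd
    have hu' : ((∑ i, e i • b i : L) : Fin N → ℤ) = (p : ℤ) • u := by
      ext j; simpa using hu j
    have huL : u ∈ L := hsat p u (by exact_mod_cast hp.ne_zero) (hu' ▸ SetLike.coe_mem _)
    have heq : ∑ i, e i • b i = (p : ℤ) • (⟨u, huL⟩ : L) := Subtype.ext hu'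
    have := congrArg (fun t => b.repr t i) heq
    simp only [b.repr_sum_self, map_smul, Finsupp.smul_apply, smul_eq_mul] at this
    rw [← he, this]; simp
  have hspan : Set.range (fun i => red (b i)) ≤ (span (ZMod p) (S.image red : Set (Fin N → ZMod p)) : Set _) := by
    rintro _ ⟨i, rfl⟩
    obtain ⟨s, hs, _, ⟨u, rfl⟩, hsu⟩ := mem_sup.1 (hle (b i).2)
    have hpu : red ((p : ℤ) • u) = 0 := by rw [hsmul]; simp
    simp only [LinearMap.lsmul_apply] at hsu
    change red (b i) ∈ _
    rw [← hsu, map_add, hpu, add_zero]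
    clear hsu
    induction hs using span_induction with
    | mem x hx => exact subset_span (by simpa using ⟨x, hx, rfl⟩)
    | zero => simp
    | add x y _ _ hx hy => rw [map_add]; exact add_mem hx hy
    | smul a x _ hx => rw [hsmul]; exact smul_mem _ _ hx
  have h1 := linearIndependent_le_span' _ hli _ hspan
  simp only [Cardinal.mk_fin, Fintype.card_coe, Finset.coe_sort_coe] at h1
  have h2 : finrank ℤ L ≤ (S.image red).card := by exact_mod_cast h1
  exact absurd (h2.trans Finset.card_image_le) (by omega)

/-- A module contained in neither of two submodules is not contained in their union. -/
theorem exists_mem_notMem_notMem {R M : Type*} [Ring R] [AddCommGroup M] [Module R M]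
    {L A A' : Submodule R M} (h : ¬ L ≤ A) (h' : ¬ L ≤ A') : ∃ t ∈ L, t ∉ A ∧ t ∉ A' := by
  obtain ⟨s, hs, hsA⟩ := SetLike.not_le_iff_exists.1 h
  obtain ⟨t, ht, htA⟩ := SetLike.not_le_iff_exists.1 h'
  by_cases hsA' : s ∈ A'
  · by_cases htA' : t ∈ A
    · refine ⟨s + t, add_mem hs ht, fun hh => hsA ?_, fun hh => htA ?_⟩
      · simpa using sub_mem hh htA'
      · simpa using sub_mem hh hsA'
    · exact ⟨t, ht, htA', htA⟩
  · exact ⟨s, hs, hsA, hsA'⟩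

/-- Chinese remainder theorem in a module, for finitely many primes. -/
theorem exists_mem_sub_eq_smul {M : Type*} [AddCommGroup M] (L : Submodule ℤ M)
    (S : Finset ℕ) (hS : ∀ p ∈ S, p.Prime) (f : ℕ → M) (hf : ∀ p ∈ S, f p ∈ L) :
    ∃ v ∈ L, ∀ p ∈ S, ∃ u, v = f p + (p : ℤ) • u := by
  classical
  induction S using Finset.induction_on with
  | empty => exact ⟨0, zero_mem _, by simp⟩
  | insert q S hq ih =>
    obtain ⟨v, hv, h⟩ := ih (fun p hp => hS p (Finset.mem_insert_of_mem hp))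
      (fun p hp => hf p (Finset.mem_insert_of_mem hp))
    have hcop : IsCoprime ((∏ p ∈ S, p : ℕ) : ℤ) (q : ℤ) := by
      rw [Nat.isCoprime_iff_coprime]
      refine Nat.Coprime.prod_left fun p hp => (Nat.coprime_primes ?_ ?_).2 ?_
      · exact hS p (Finset.mem_insert_of_mem hp)
      · exact hS q (Finset.mem_insert_self _ _)
      · rintro rfl; exact hq hp
    obtain ⟨a, b, hab⟩ := hcop
    have hfq := hf q (Finset.mem_insert_self _ _)
    refine ⟨v + (a * (∏ p ∈ S, p : ℕ)) • (f q - v), add_mem hv (smul_mem _ _ (sub_mem hfq hv)), ?_⟩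
    intro p hp
    rcases Finset.mem_insert.1 hp with rfl | hp
    · refine ⟨-b • (f p - v), ?_⟩
      rw [eq_sub_of_add_eq hab]
      module
    · obtain ⟨u, hu⟩ := h p hp
      obtain ⟨c, hc⟩ := Finset.dvd_prod_of_mem (fun p : ℕ => p) hp
      refine ⟨u + (a * c) • (f q - v), ?_⟩
      rw [hc]
      push_cast
      nth_rewrite 1 [hu]
      module

/-- The kernel of a functional on a saturated sublattice is saturated. -/
theorem mem_map_ker_of_smul_mem {N : ℕ} {K : Submodule ℤ (Fin N → ℤ)}
    (hsat : ∀ (c : ℤ) (v : Fin N → ℤ), c ≠ 0 → c • v ∈ K → v ∈ K) (φ : K →ₗ[ℤ] ℤ)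
    (c : ℤ) (v : Fin N → ℤ) (hc : c ≠ 0) (h : c • v ∈ (LinearMap.ker φ).map K.subtype) :
    v ∈ (LinearMap.ker φ).map K.subtype := by
  obtain ⟨t, ht, htv⟩ := h
  have hv : v ∈ K := hsat c v hc (htv ▸ t.2)
  refine ⟨⟨v, hv⟩, ?_, rfl⟩
  have htv' : t = c • (⟨v, hv⟩ : K) := Subtype.ext htv
  have h0 : φ t = 0 := ht
  rw [htv', map_smul, smul_eq_mul, mul_eq_zero] at h0
  exact h0.resolve_left hc

theorem le_finrank_ker_add_finrank {M M' : Type*} [AddCommGroup M] [AddCommGroup M']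
    [Module.Finite ℤ M] [Module.Free ℤ M'] [Module.Finite ℤ M'] (f : M →ₗ[ℤ] M') :
    finrank ℤ M ≤ finrank ℤ (LinearMap.ker f) + finrank ℤ M' := by
  have h1 := Submodule.finrank_quotient_add_finrank (LinearMap.ker f)
  have h2 := f.quotKerEquivRange.finrank_eq
  have h3 := Submodule.finrank_le (LinearMap.range f)
  omega

theorem two_le_finrank_map_ker {N : ℕ} {K : Submodule ℤ (Fin N → ℤ)}
    (hrank : 3 ≤ finrank ℤ K) (φ : K →ₗ[ℤ] ℤ) :
    2 ≤ finrank ℤ ((LinearMap.ker φ).map K.subtype) := by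
  rw [finrank_map_subtype_eq]
  have := le_finrank_ker_add_finrank φ
  rw [finrank_self] at this
  omega

/-- In a saturated sublattice of rank at least three there is a vector avoiding the lines of `w`
and `w'` modulo all primes, and their planes with `x` modulo the primes dividing `D`. -/
theorem exists_mem_forall_notMem_modSpan {N : ℕ} {K : Submodule ℤ (Fin N → ℤ)}
    (hsat : ∀ (c : ℤ) (v : Fin N → ℤ), c ≠ 0 → c • v ∈ K → v ∈ K)
    (hrank : 3 ≤ finrank ℤ K) (w w' x : Fin N → ℤ) {D : ℤ} (hD : D ≠ 0)
    (φ : K →ₗ[ℤ] ℤ) (hφ : φ ≠ 0)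
    (h : ∀ q : ℕ, q.Prime → ¬ (q : ℤ) ∣ D → ∀ v : K,
      (v : Fin N → ℤ) ∈ modSpan q {w} ∨ (v : Fin N → ℤ) ∈ modSpan q {w'} → (q : ℤ) ∣ φ v) :
    ∃ v ∈ K, ∀ p : ℕ, p.Prime → (v ∉ modSpan p {w} ∧ v ∉ modSpan p {w'}) ∧
      ((p : ℤ) ∣ D → v ∉ modSpan p {w, x} ∧ v ∉ modSpan p {w', x}) := by
  classical
  obtain ⟨f, hf⟩ : ∃ f, φ f ≠ 0 := by
    by_contra! hh
    exact hφ (LinearMap.ext hh)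
  have hDc : D * φ f ≠ 0 := mul_ne_zero hD hf
  have hplane : ∀ p : ℕ, ∃ t, p.Prime → t ∈ K ∧ t ∉ modSpan p {w, x} ∧ t ∉ modSpan p {w', x} := by
    intro p
    by_cases hp : p.Prime
    · have h1 := not_le_modSpan hsat {w, x} (Finset.card_le_two.trans_lt hrank) hp
      have h2 := not_le_modSpan hsat {w', x} (Finset.card_le_two.trans_lt hrank) hp
      simp only [Finset.coe_pair] at h1 h2
      obtain ⟨t, ht⟩ := exists_mem_notMem_notMem h1 h2
      exact ⟨t, fun _ => ht⟩
    · exact ⟨0, fun hp' => absurd hp' hp⟩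
  choose t htp using hplane
  have hshift : ∀ {p : ℤ} {A : Set (Fin N → ℤ)} {a : Fin N → ℤ} (u : Fin N → ℤ),
      a ∉ modSpan p A → a + p • u ∉ modSpan p A := fun u ha hau =>
    ha (by simpa using sub_mem hau (smul_mem_modSpan _ _ u))
  have hprime : ∀ {p : ℕ} {m : ℤ}, m ≠ 0 → (p ∈ m.natAbs.primeFactors ↔ p.Prime ∧ (p : ℤ) ∣ m) := by
    intro p m hm
    rw [Nat.mem_primeFactors, ← Int.natCast_dvd]
    simp [hm]
  obtain ⟨v₁, hv₁, hv₁t⟩ : ∃ v₁ : K, φ v₁ ≠ 0 ∧ ∀ p : ℕ, p.Prime → (p : ℤ) ∣ D * φ f →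
      ∃ u, (v₁ : Fin N → ℤ) = t p + (p : ℤ) • u := by
    obtain ⟨v₀, hv₀, hv₀t⟩ := exists_mem_sub_eq_smul K (D * φ f).natAbs.primeFactors
      (fun p hp => ((hprime hDc).1 hp).1) t (fun p hp => (htp p ((hprime hDc).1 hp).1).1)
    by_cases h0 : φ ⟨v₀, hv₀⟩ = 0
    · refine ⟨⟨v₀, hv₀⟩ + (D * φ f) • f, ?_, ?_⟩
      · rw [map_add, h0, zero_add, map_smul]
        exact mul_ne_zero hDc hf
      · rintro p hp hpd
        obtain ⟨u, hu⟩ := hv₀t p ((hprime hDc).2 ⟨hp, hpd⟩)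
        obtain ⟨e, he⟩ := hpd
        refine ⟨u + e • (f : Fin N → ℤ), ?_⟩
        simp only [Submodule.coe_add, Submodule.coe_smul, he, hu]
        module
    · exact ⟨⟨v₀, hv₀⟩, h0, fun p hp hpd => hv₀t p ((hprime hDc).2 ⟨hp, hpd⟩)⟩
  set L := (LinearMap.ker φ).map K.subtype with hL
  have hline : ∀ q : ℕ, ∃ u, q.Prime → (q : ℤ) ∣ φ v₁ → ¬ (q : ℤ) ∣ D * φ f →
      u ∈ L ∧ (v₁ : Fin N → ℤ) + u ∉ modSpan q {w} ∧ (v₁ : Fin N → ℤ) + u ∉ modSpan q {w'} := by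
    intro q
    by_cases hq : q.Prime ∧ (q : ℤ) ∣ φ v₁ ∧ ¬ (q : ℤ) ∣ D * φ f
    · obtain ⟨hq, ⟨k, hk⟩, hqD⟩ := hq
      have hLsat := mem_map_ker_of_smul_mem hsat φ
      have hLrank := two_le_finrank_map_ker hrank φ
      have h1 := not_le_modSpan hLsat {w} (by rwa [Finset.card_singleton]) hq
      have h2 := not_le_modSpan hLsat {w'} (by rwa [Finset.card_singleton]) hq
      simp only [Finset.coe_singleton] at h1 h2
      obtain ⟨s, hs, hs1, hs2⟩ := exists_mem_notMem_notMem h1 h2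
      have hcop : IsCoprime (φ f) (q : ℤ) :=
        ((Nat.prime_iff_prime_int.1 hq).coprime_iff_not_dvd.2
          fun hh => hqD (hh.mul_left D)).symm
      obtain ⟨a, b, hab⟩ := hcop
      have hκ : (((φ f) • v₁ - (φ v₁) • f : K) : Fin N → ℤ) ∈ L :=
        ⟨φ f • v₁ - φ v₁ • f, by simp [mul_comm], rfl⟩
      have heq : (v₁ : Fin N → ℤ) + (s - a • (((φ f) • v₁ - (φ v₁) • f : K) : Fin N → ℤ)) =
          s + (q : ℤ) • (b • (v₁ : Fin N → ℤ) + (a * k) • (f : Fin N → ℤ)) := by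
        have : (v₁ : Fin N → ℤ) = (a * φ f + b * q) • (v₁ : Fin N → ℤ) := by rw [hab, one_smul]
        nth_rewrite 1 [this]
        simp only [Submodule.coe_sub, Submodule.coe_smul, hk]
        module
      refine ⟨s - a • (((φ f) • v₁ - (φ v₁) • f : K) : Fin N → ℤ), fun _ _ _ =>
        ⟨sub_mem hs (smul_mem _ _ hκ), ?_, ?_⟩⟩
      · rw [heq]; exact hshift _ hs1
      · rw [heq]; exact hshift _ hs2
    · exact ⟨0, fun h1 h2 h3 => absurd ⟨h1, h2, h3⟩ hq⟩
  choose r hr using hline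
  obtain ⟨u, huL, hu⟩ := exists_mem_sub_eq_smul L (D * φ f * φ v₁).natAbs.primeFactors
    (fun p hp => ((hprime (mul_ne_zero hDc hv₁)).1 hp).1)
    (fun q => if (q : ℤ) ∣ D * φ f then 0 else r q) (by
      intro q hq
      obtain ⟨hq, hqd⟩ := (hprime (mul_ne_zero hDc hv₁)).1 hq
      by_cases hqD : (q : ℤ) ∣ D * φ f
      · simp [hqD]
      · simp only [hqD, if_false]
        exact (hr q hq (((Nat.prime_iff_prime_int.1 hq).dvd_or_dvd hqd).resolve_left hqD) hqD).1)
  obtain ⟨u', hu'ker, rfl⟩ := huL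
  have hφu : φ (v₁ + u') = φ v₁ := by
    rw [map_add, show φ u' = 0 from hu'ker, add_zero]
  refine ⟨(v₁ + u' : K), Subtype.coe_prop _, fun p hp => ?_⟩
  by_cases hpD : (p : ℤ) ∣ D * φ f
  · obtain ⟨e, he⟩ := hv₁t p hp hpD
    obtain ⟨e', he'⟩ := hu p ((hprime (mul_ne_zero hDc hv₁)).2 ⟨hp, hpD.mul_right _⟩)
    have heq : ((v₁ + u' : K) : Fin N → ℤ) = t p + (p : ℤ) • (e + e') := by
      simp only [hpD, if_true, Submodule.subtype_apply] at he'
      rw [Submodule.coe_add, he, he']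
      module
    obtain ⟨-, ht1, ht2⟩ := htp p hp
    have key : ((v₁ + u' : K) : Fin N → ℤ) ∉ modSpan p {w, x} ∧
        ((v₁ + u' : K) : Fin N → ℤ) ∉ modSpan p {w', x} := by
      rw [heq]; exact ⟨hshift _ ht1, hshift _ ht2⟩
    exact ⟨⟨fun hh => key.1 (modSpan_mono _ (by simp) hh),
      fun hh => key.2 (modSpan_mono _ (by simp) hh)⟩, fun _ => key⟩
  · refine ⟨?_, fun hp' => absurd (hp'.mul_right _) hpD⟩
    by_cases hpv : (p : ℤ) ∣ φ v₁
    · obtain ⟨e, he⟩ := hu p ((hprime (mul_ne_zero hDc hv₁)).2 ⟨hp, hpv.mul_left _⟩)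
      simp only [hpD, if_false, Submodule.subtype_apply] at he
      rw [Submodule.coe_add, he, ← add_assoc]
      obtain ⟨-, h1, h2⟩ := hr p hp hpv hpD
      exact ⟨hshift _ h1, hshift _ h2⟩
    · have := h p hp (fun hh => hpD (hh.mul_right _)) (v₁ + u')
      rw [hφu] at this
      exact ⟨fun hh => hpv (this (.inl hh)), fun hh => hpv (this (.inr hh))⟩

/-- Two vectors of a sublattice of rank at least three are killed by a nonzero functional. -/
theorem exists_ne_zero_apply_eq_zero {M : Type*} [AddCommGroup M] [Module.Free ℤ M]
    [Module.Finite ℤ M] (hrank : 3 ≤ finrank ℤ M) (w w' : M) :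
    ∃ φ : M →ₗ[ℤ] ℤ, φ ≠ 0 ∧ φ w = 0 ∧ φ w' = 0 := by
  let ev : Dual ℤ M →ₗ[ℤ] ℤ × ℤ := (Dual.eval ℤ M w).prod (Dual.eval ℤ M w')
  have hni : ¬ Function.Injective ev := fun hinj => by
    have := LinearMap.finrank_le_finrank_of_injective hinj
    rw [finrank_linearMap, finrank_prod, finrank_self, mul_one] at this
    omega
  rw [← LinearMap.ker_eq_bot, Submodule.eq_bot_iff] at hni
  push Not at hni
  obtain ⟨φ, hφ, hφ0⟩ := hni
  have := Prod.ext_iff.1 (LinearMap.mem_ker.1 hφ)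
  exact ⟨φ, hφ0, this.1, this.2⟩

/-- The symplectic form as a linear map in its first argument. -/
def sympLeft {g : ℕ} (y : Fin (2 * g) → ℤ) : (Fin (2 * g) → ℤ) →ₗ[ℤ] ℤ where
  toFun v := symp v y
  map_add' u v := symp_add_left u v y
  map_smul' c v := symp_smul_left c v y

theorem symp_swap {R : Type*} [CommRing R] {g : ℕ} (x y : Fin (2 * g) → R) :
    symp x y = -symp y x := by
  unfold symp
  rw [← Finset.sum_neg_distrib]
  exact Finset.sum_congr rfl fun i _ => by ring

theorem symp_self {R : Type*} [CommRing R] {g : ℕ} (x : Fin (2 * g) → R) : symp x x = 0 := by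
  unfold symp
  exact Finset.sum_eq_zero fun i _ => by ring

theorem symp_eq_zero_comm {R : Type*} [CommRing R] {g : ℕ} {x y : Fin (2 * g) → R} :
    symp x y = 0 ↔ symp y x = 0 := by
  rw [symp_swap, neg_eq_zero]

theorem symp_stdA {R : Type*} [CommRing R] {g j : ℕ} (hj : j < g) (v : Fin (2 * g) → R) :
    symp (stdA R g j) v = v ⟨2 * j + 1, by omega⟩ := by
  unfold symp stdA
  rw [Finset.sum_eq_single ⟨j, hj⟩]
  · simp
  · intro i _ hi
    have h1 : (i : ℕ) ≠ j := fun h => hi (Fin.ext h)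
    have h2 : ¬ 2 * (i : ℕ) + 1 = 2 * j := by omega
    simp [h1, h2]
  · simp

theorem symp_stdB {R : Type*} [CommRing R] {g j : ℕ} (hj : j < g) (v : Fin (2 * g) → R) :
    symp v (stdB R g j) = v ⟨2 * j, by omega⟩ := by
  unfold symp stdB
  rw [Finset.sum_eq_single ⟨j, hj⟩]
  · simp
  · intro i _ hi
    have h1 : (i : ℕ) ≠ j := fun h => hi (Fin.ext h)
    have h2 : ¬ 2 * (i : ℕ) = 2 * j + 1 := by omega
    simp [h1, h2]
  · simp

theorem symp_qcast {g : ℕ} (x y : Fin (2 * g) → ℤ) :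
    symp (qcast x) (qcast y) = ((symp x y : ℤ) : ℚ) := by
  simp [symp, qcast]

theorem qcast_stdA (g j : ℕ) : qcast (stdA ℤ g j) = stdA ℚ g j := by
  ext i; simp [qcast, stdA]

theorem qcast_stdB (g j : ℕ) : qcast (stdB ℤ g j) = stdB ℚ g j := by
  ext i; simp [qcast, stdB]

theorem isUnimodular_swap {n : ℕ} {a b c : Fin n → ℤ} (h : IsUnimodular ![a, b, c]) :
    IsUnimodular ![a, c, b] := by
  rw [isUnimodular_three_iff] at h ⊢
  intro p hp r s t u hu
  obtain ⟨h1, h2, h3⟩ := h p hp r t s u (by rw [← hu]; abel)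
  exact ⟨h1, h3, h2⟩

theorem isUnimodular_pair_of_three {n : ℕ} {a b c : Fin n → ℤ} (h : IsUnimodular ![a, b, c]) :
    IsUnimodular ![a, b] := by
  rw [isUnimodular_three_iff] at h
  rw [isUnimodular_two_iff]
  intro p hp r s u hu
  obtain ⟨h1, h2, -⟩ := h p hp r s 0 u (by rw [← hu]; simp)
  exact ⟨h1, h2⟩

theorem isUnimodular_right_of_pair {n : ℕ} {a b : Fin n → ℤ} (h : IsUnimodular ![a, b]) :
    IsUnimodular ![b] := by
  rw [isUnimodular_two_iff] at h
  rw [isUnimodular_one_iff]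
  intro p hp r u hu
  exact (h p hp 0 r u (by rw [← hu]; simp)).2

/-- A relation modulo `p` can be solved for a vector whose coefficient is prime to `p`. -/
theorem exists_eq_add_smul_of_smul_eq {N : ℕ} {p : ℕ} (hp : p.Prime) {t : ℤ} (ht : ¬ (p : ℤ) ∣ t)
    {a v u : Fin N → ℤ} (h : a + t • v = (p : ℤ) • u) :
    ∃ (e : ℤ) (u' : Fin N → ℤ), v = e • a + (p : ℤ) • u' := by
  obtain ⟨α, β, hαβ⟩ := ((Nat.prime_iff_prime_int.1 hp).coprime_iff_not_dvd.2 ht).symm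
  refine ⟨-α, α • u + β • v, ?_⟩
  have h1 : v = (α * t + β * p) • v := by rw [hαβ, one_smul]
  rw [eq_sub_of_add_eq h]
  nth_rewrite 1 [h1]
  module

theorem isUnimodular_three_of_forall_notMem_modSpan {N m : ℕ} {x w v : Fin N → ℤ} {j : Fin N}
    (hj : (j : ℕ) < m) (hxw : IsUnimodular ![x, w]) (hw : w ∈ coordZero ℤ N m)
    (hv : v ∈ coordZero ℤ N m) (hline : ∀ p : ℕ, p.Prime → v ∉ modSpan p {w})
    (hplane : ∀ p : ℕ, p.Prime → (p : ℤ) ∣ x j → v ∉ modSpan p {w, x}) :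
    IsUnimodular ![x, w, v] := by
  rw [isUnimodular_two_iff] at hxw
  rw [isUnimodular_three_iff]
  intro p hp r s t u hu
  have ht : (p : ℤ) ∣ t := by
    by_contra ht
    by_cases hpx : (p : ℤ) ∣ x j
    · obtain ⟨e, u', hv'⟩ := exists_eq_add_smul_of_smul_eq hp ht hu
      exact hplane p hp hpx (mem_modSpan_pair.2 ⟨e * s, e * r, u', by rw [hv']; module⟩)
    · have hr : (p : ℤ) ∣ r := by
        have := congrFun hu j
        simp only [Pi.add_apply, Pi.smul_apply, smul_eq_mul, hw j hj, hv j hj, mul_zero,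
          add_zero] at this
        exact ((Nat.prime_iff_prime_int.1 hp).dvd_or_dvd ⟨_, this⟩).resolve_right hpx
      obtain ⟨k, rfl⟩ := hr
      obtain ⟨e, u', hv'⟩ := exists_eq_add_smul_of_smul_eq hp ht
        (show s • w + t • v = (p : ℤ) • (u - k • x) by rw [smul_sub, ← hu]; module)
      exact hline p hp (mem_modSpan_singleton.2 ⟨e * s, u', by rw [hv']; module⟩)
  obtain ⟨k, rfl⟩ := ht
  obtain ⟨hr, hs⟩ := hxw p hp r s (u - k • v) (by rw [smul_sub, ← hu]; module)
  exact ⟨hr, hs, dvd_mul_right _ _⟩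

theorem isUnimodular_three_of_forall_notMem_modSpan_sub {N : ℕ} {x a v : Fin N → ℤ} {j : Fin N}
    (ha : a j = 1) (hv : v j = 0) (hxa : IsUnimodular ![x, a])
    (hline : ∀ p : ℕ, p.Prime → v ∉ modSpan p {x - x j • a}) :
    IsUnimodular ![x, a, v] := by
  rw [isUnimodular_two_iff] at hxa
  rw [isUnimodular_three_iff]
  intro p hp r s t u hu
  have ht : (p : ℤ) ∣ t := by
    by_contra ht
    have hj := congrFun hu j
    simp only [Pi.add_apply, Pi.smul_apply, smul_eq_mul, ha, hv, mul_zero, mul_one,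
      add_zero] at hj
    obtain rfl : s = p * u j - r * x j := by linarith
    obtain ⟨e, u', hv'⟩ := exists_eq_add_smul_of_smul_eq hp ht
      (show r • (x - x j • a) + t • v = (p : ℤ) • (u - u j • a) by
        rw [smul_sub (p : ℤ), ← hu]; module)
    exact hline p hp (mem_modSpan_singleton.2 ⟨e * r, u', by rw [hv']; module⟩)
  obtain ⟨k, rfl⟩ := ht
  obtain ⟨hr, hs⟩ := hxa p hp r s (u - k • v) (by rw [smul_sub, ← hu]; module)
  exact ⟨hr, hs, dvd_mul_right _ _⟩

/-- A vector orthogonal to few given ones and avoiding lines and planes modulo primes. -/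
theorem exists_orthogonal_forall_notMem_modSpan {g m : ℕ} {ι : Type*} [Fintype ι]
    (hcard : m + Fintype.card ι + 6 ≤ 2 * g) (y : ι → Fin (2 * g) → ℤ)
    (x w w' : Fin (2 * g) → ℤ) {D : ℤ} (hD : D ≠ 0)
    (hw : w ∈ coordZero ℤ (2 * g) m) (hwy : ∀ i, symp w (y i) = 0) (hwx : symp w x = 0)
    (hw' : w' ∈ coordZero ℤ (2 * g) m) (hwy' : ∀ i, symp w' (y i) = 0) (hwx' : symp w' x = 0) :
    ∃ v ∈ coordZero ℤ (2 * g) m, (∀ i, symp v (y i) = 0) ∧ symp v x = 0 ∧ symp v w = 0 ∧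
      symp v w' = 0 ∧ ∀ p : ℕ, p.Prime → (v ∉ modSpan p {w} ∧ v ∉ modSpan p {w'}) ∧
        ((p : ℤ) ∣ D → v ∉ modSpan p {w, x} ∧ v ∉ modSpan p {w', x}) := by
  let F : (Fin (2 * g) → ℤ) →ₗ[ℤ] (Fin m ⊕ ι ⊕ Fin 3 → ℤ) :=
    LinearMap.pi (Sum.elim (fun i => LinearMap.proj (Fin.castLE (by omega) i))
      (Sum.elim (fun i => sympLeft (y i)) ![sympLeft x, sympLeft w, sympLeft w']))
  have hF : ∀ v, v ∈ LinearMap.ker F ↔ v ∈ coordZero ℤ (2 * g) m ∧ (∀ i, symp v (y i) = 0) ∧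
      symp v x = 0 ∧ symp v w = 0 ∧ symp v w' = 0 := by
    intro v
    have : v ∈ coordZero ℤ (2 * g) m ↔ ∀ i : Fin m, v (Fin.castLE (by omega) i) = 0 :=
      ⟨fun h i => h _ i.2, fun h j hj => h ⟨j, hj⟩⟩
    rw [this, LinearMap.mem_ker, funext_iff]
    simp [F, Sum.forall, Fin.forall_fin_succ, sympLeft]
  have hsat : ∀ (c : ℤ) (v : Fin (2 * g) → ℤ), c ≠ 0 → c • v ∈ LinearMap.ker F →
      v ∈ LinearMap.ker F := by
    intro c v hc h
    rw [LinearMap.mem_ker, map_smul, smul_eq_zero] at h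
    exact h.resolve_left hc
  have hrank : 3 ≤ finrank ℤ (LinearMap.ker F) := by
    have := le_finrank_ker_add_finrank F
    simp only [finrank_fintype_fun_eq_card, Fintype.card_fin, Fintype.card_sum] at this
    omega
  suffices H : ∃ D' : ℤ, D' ≠ 0 ∧ D ∣ D' ∧ ∃ φ : LinearMap.ker F →ₗ[ℤ] ℤ, φ ≠ 0 ∧
      ∀ q : ℕ, q.Prime → ¬ (q : ℤ) ∣ D' → ∀ v : LinearMap.ker F,
        (v : Fin (2 * g) → ℤ) ∈ modSpan q {w} ∨ (v : Fin (2 * g) → ℤ) ∈ modSpan q {w'} →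
          (q : ℤ) ∣ φ v by
    obtain ⟨D', hD', hDD', φ, hφ, h⟩ := H
    obtain ⟨v, hv, hvp⟩ := exists_mem_forall_notMem_modSpan hsat hrank w w' x hD' φ hφ h
    obtain ⟨h1, h2, h3, h4, h5⟩ := (hF v).1 hv
    exact ⟨v, h1, h2, h3, h4, h5, fun p hp => ⟨(hvp p hp).1, fun hpD =>
      (hvp p hp).2 (hpD.trans hDD')⟩⟩
  have hmul : ∀ (q : ℕ), q.Prime → ∀ (φ : LinearMap.ker F →ₗ[ℤ] ℤ) (v a : LinearMap.ker F)
      (c : ℤ) (u : Fin (2 * g) → ℤ), φ a = 0 →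
        (v : Fin (2 * g) → ℤ) = c • (a : Fin (2 * g) → ℤ) + (q : ℤ) • u → (q : ℤ) ∣ φ v := by
    intro q hq φ v a c u ha hv
    have hu : u ∈ LinearMap.ker F := by
      refine hsat q u (by exact_mod_cast hq.ne_zero) ?_
      rw [← sub_eq_iff_eq_add'.2 hv]
      exact sub_mem v.2 (smul_mem _ _ a.2)
    have : v = c • a + (q : ℤ) • (⟨u, hu⟩ : LinearMap.ker F) := Subtype.ext hv
    rw [this, map_add, map_smul, map_smul, ha, smul_zero, zero_add]
    exact dvd_mul_right _ _
  by_cases hm : symp w w' = 0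
  · let W : LinearMap.ker F := ⟨w, (hF w).2 ⟨hw, hwy, hwx, symp_self w, hm⟩⟩
    let W' : LinearMap.ker F :=
      ⟨w', (hF w').2 ⟨hw', hwy', hwx', symp_eq_zero_comm.1 hm, symp_self w'⟩⟩
    obtain ⟨φ, hφ, hφw, hφw'⟩ := exists_ne_zero_apply_eq_zero hrank W W'
    refine ⟨D, hD, dvd_rfl, φ, hφ, fun q hq _ v hv => ?_⟩
    rcases hv with hv | hv
    · obtain ⟨c, u, hv⟩ := mem_modSpan_singleton.1 hv
      exact hmul q hq φ v W c u hφw hv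
    · obtain ⟨c, u, hv⟩ := mem_modSpan_singleton.1 hv
      exact hmul q hq φ v W' c u hφw' hv
  · obtain ⟨φ, hφ, -, -⟩ := exists_ne_zero_apply_eq_zero hrank 0 0
    refine ⟨D * symp w w', mul_ne_zero hD hm, dvd_mul_right _ _, φ, hφ, fun q hq hqD v hv => ?_⟩
    have hqm : ¬ (q : ℤ) ∣ symp w w' := fun h => hqD (h.mul_left _)
    have hker : ∀ (a b : Fin (2 * g) → ℤ), symp v b = 0 → ¬ (q : ℤ) ∣ symp a b →
        (v : Fin (2 * g) → ℤ) ∈ modSpan q {a} → (q : ℤ) ∣ φ v := by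
      intro a b hvb hab hva
      obtain ⟨c, u, hva⟩ := mem_modSpan_singleton.1 hva
      rw [hva, symp_add_left, symp_smul_left, symp_smul_left] at hvb
      obtain ⟨k, rfl⟩ : (q : ℤ) ∣ c := by
        refine ((Nat.prime_iff_prime_int.1 hq).dvd_or_dvd (b := symp a b)
          ⟨-symp u b, ?_⟩).resolve_right hab
        linarith
      exact hmul q hq φ v 0 0 (k • a + u) (map_zero φ) (by rw [hva]; simp [mul_smul])
    obtain ⟨-, -, -, hvw, hvw'⟩ := (hF v).1 v.2
    rcases hv with hv | hv
    · exact hker w w' hvw' hqm hv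
    · exact hker w' w hvw (by rwa [symp_swap, dvd_neg]) hv

/-- A reflexive-transitive chain as a finite sequence. -/
theorem exists_fin_path {α : Type*} {r : α → α → Prop} {P : α → Prop}
    (hP : ∀ a b, r a b → P b) {a b : α} (ha : P a) (h : Relation.ReflTransGen r a b) :
    ∃ (N : ℕ) (c : Fin (N + 1) → α), c 0 = a ∧ c (Fin.last N) = b ∧ (∀ i, P (c i)) ∧
      ∀ i : Fin N, r (c i.castSucc) (c i.succ) := by
  induction h with
  | refl => exact ⟨0, fun _ => a, rfl, rfl, fun _ => ha, fun i => i.elim0⟩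
  | tail _ hbc ih =>
    obtain ⟨N, c, h0, hN, hPc, hr⟩ := ih
    refine ⟨N + 1, Fin.snoc c _, ?_, Fin.snoc_last _ _, ?_, ?_⟩
    · rw [← Fin.castSucc_zero, Fin.snoc_castSucc, h0]
    · refine Fin.lastCases ?_ fun i => ?_
      · rw [Fin.snoc_last]; exact hP _ _ hbc
      · rw [Fin.snoc_castSucc]; exact hPc i
    · refine Fin.lastCases ?_ fun i => ?_
      · rw [Fin.snoc_castSucc, Fin.succ_last, Fin.snoc_last, hN]; exact hbc
      · rw [Fin.snoc_castSucc, Fin.succ_castSucc, Fin.snoc_castSucc]; exact hr i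

end

/-- Lemma 3.16 — connectivity of the auxiliary graph. -/
theorem stmt16 (g k n : ℕ) (hk1 : 1 ≤ k) (hk5 : k ≤ 5) (hn : n + 4 ≤ g)
    (x : Fin (2 * g) → ℤ) (hxprim : Primitive x)
    (hxH : x ∈ coordZero ℤ (2 * g) (2 * (k - 1)))
    (hxnot : ¬(x ∈ coordZero ℤ (2 * g) (2 * k) ∨ ∃ i < 4, x = stdA ℤ g i))
    (x' : Fin (2 * g) → ℤ) (hx'prim : Primitive x')
    (hx'H : x' ∈ coordZero ℤ (2 * g) (2 * (k - 1)) ∨ ∃ i < 4, x' = stdA ℤ g i)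
    (hxx' : symp x x' = 0) (hgcd2 : IsUnimodular ![x, x'])
    (B : Set (Fin (2 * g) → ℚ))
    (hBli : LinearIndependent ℚ (fun z : B => (z : Fin (2 * g) → ℚ)))
    (hBspan : Submodule.span ℚ B = perp {qcast x, qcast x'})
    (hBab : ∀ j : ℕ, j < k - 1 → stdA ℚ g j ∈ B ∧ stdB ℚ g j ∈ B)
    (hBdesc : ∀ z ∈ B, (∃ j : ℕ, j < k - 1 ∧ z = stdB ℚ g j) ∨
      ∃ y : Fin (2 * g) → ℤ, Primitive y ∧
        (y ∈ coordZero ℤ (2 * g) (2 * (k - 1)) ∨ ∃ i < 4, y = stdA ℤ g i) ∧ z = qcast y)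
    (z : Fin n → Fin (2 * g) → ℚ)
    (hzinj : Function.Injective z) (hzB : ∀ i, z i ∈ B) :
    let Vtx : (Fin (2 * g) → ℤ) → Prop := fun wv =>
      Primitive wv ∧ (wv ∈ coordZero ℤ (2 * g) (2 * k) ∨ ∃ i < 4, wv = stdA ℤ g i) ∧
        (∀ i, symp (qcast wv) (z i) = 0) ∧ symp x wv = 0 ∧ IsUnimodular ![x, wv]
    ∀ w w' : Fin (2 * g) → ℤ, Vtx w → Vtx w' →
      ∃ (N : ℕ) (c : Fin (N + 1) → Fin (2 * g) → ℤ),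
        c 0 = w ∧ c (Fin.last N) = w' ∧ (∀ i, Vtx (c i)) ∧
        ∀ i : Fin N,
          (∀ a b : Fin 3, a ≠ b →
            symp (![x, c i.castSucc, c i.succ] a) (![x, c i.castSucc, c i.succ] b) = 0) ∧
          IsUnimodular ![x, c i.castSucc, c i.succ] := by
  intro Vtx w w' hw hw'
  let E : (Fin (2 * g) → ℤ) → (Fin (2 * g) → ℤ) → Prop := fun u v =>
    Vtx u ∧ Vtx v ∧ symp u v = 0 ∧ IsUnimodular ![x, u, v]
  have hEsymm : ∀ u v, E u v → E v u := fun u v h =>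
    ⟨h.2.1, h.1, symp_eq_zero_comm.1 h.2.2.1, isUnimodular_swap h.2.2.2⟩
  suffices H : Relation.ReflTransGen E w w' by
    obtain ⟨N, c, h0, hN, hV, hE⟩ := exists_fin_path (P := Vtx) (fun a b h => h.2.1) hw H
    refine ⟨N, c, h0, hN, hV, fun i => ⟨?_, (hE i).2.2.2⟩⟩
    have h1 : symp x (c i.castSucc) = 0 := (hV _).2.2.2.1
    have h2 : symp x (c i.succ) = 0 := (hV _).2.2.2.1
    have h3 : symp (c i.castSucc) (c i.succ) = 0 := (hE i).2.2.1
    simp [Fin.forall_fin_succ, h1, h2, h3, symp_eq_zero_comm.1 h1, symp_eq_zero_comm.1 h2,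
      symp_eq_zero_comm.1 h3]
  by_cases hA : ∃ j < k - 1, ∀ i, symp (qcast (stdA ℤ g j)) (z i) = 0
  · obtain ⟨j, hj, hjz⟩ := hA
    have hjg : j < g := by omega
    have hcol : ∀ v : Fin (2 * g) → ℤ, v ⟨2 * j, by omega⟩ = 0 → IsUnimodular ![x, v] →
        IsUnimodular ![x, stdA ℤ g j, v] := by
      intro v hv hxv
      rw [isUnimodular_two_iff] at hxv
      rw [isUnimodular_three_iff]
      intro p hp r s t u hu
      have hs : (p : ℤ) ∣ s := by
        refine ⟨u ⟨2 * j, by omega⟩, ?_⟩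
        have := congrFun hu ⟨2 * j, by omega⟩
        have hx0 : x ⟨2 * j, by omega⟩ = 0 := hxH _ (by simp only; omega)
        simpa [stdA, hv, hx0] using this
      obtain ⟨l, rfl⟩ := hs
      obtain ⟨h1, h2⟩ := hxv p hp r t (u - l • stdA ℤ g j) (by rw [smul_sub, ← hu]; module)
      exact ⟨h1, dvd_mul_right _ _, h2⟩
    have hxa : IsUnimodular ![x, stdA ℤ g j] := by
      rw [Primitive, isUnimodular_one_iff] at hxprim
      rw [isUnimodular_two_iff]
      intro p hp r s u hu
      have hs : (p : ℤ) ∣ s := by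
        refine ⟨u ⟨2 * j, by omega⟩, ?_⟩
        have := congrFun hu ⟨2 * j, by omega⟩
        have hx0 : x ⟨2 * j, by omega⟩ = 0 := hxH _ (by simp only; omega)
        simpa [stdA, hx0] using this
      obtain ⟨l, rfl⟩ := hs
      exact ⟨hxprim p hp r (u - l • stdA ℤ g j) (by rw [smul_sub, ← hu]; module),
        dvd_mul_right _ _⟩
    have hVa : Vtx (stdA ℤ g j) := by
      refine ⟨isUnimodular_right_of_pair hxa, .inr ⟨j, by omega, rfl⟩, hjz, ?_, hxa⟩
      rw [symp_eq_zero_comm, symp_stdA hjg]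
      exact hxH _ (by simp only; omega)
    have hadj : ∀ v, Vtx v → Relation.ReflTransGen E (stdA ℤ g j) v ∧
        Relation.ReflTransGen E v (stdA ℤ g j) := by
      intro v hv
      by_cases hva : v = stdA ℤ g j
      · rw [hva]; exact ⟨.refl, .refl⟩
      · have hv0 : v ⟨2 * j, by omega⟩ = 0 ∧ v ⟨2 * j + 1, by omega⟩ = 0 := by
          rcases hv.2.1 with hv | ⟨i, hi, rfl⟩
          · exact ⟨hv _ (by simp only; omega), hv _ (by simp only; omega)⟩
          · have hij : j ≠ i := by rintro rfl; exact hva rfl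
            have : 2 * j + 1 ≠ 2 * i := by omega
            simp [stdA, hij, this]
        have hEv : E (stdA ℤ g j) v :=
          ⟨hVa, hv, by rw [symp_stdA hjg]; exact hv0.2, hcol v hv0.1 hv.2.2.2.2⟩
        exact ⟨.single hEv, .single (hEsymm _ _ hEv)⟩
    exact (hadj w hw).2.trans (hadj w' hw').1
  · push Not at hA
    have hσ : ∀ j : Fin (k - 1), ∃ i, z i = stdB ℚ g j := by
      intro j
      obtain ⟨i, hi⟩ := hA j j.2
      refine ⟨i, ?_⟩
      have hjg : (j : ℕ) < g := by have := j.2; omega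
      rw [qcast_stdA, symp_stdA hjg] at hi
      rcases hBdesc (z i) (hzB i) with ⟨l, hl, hzl⟩ | ⟨y, -, hy, hzy⟩
      · rw [hzl] at hi ⊢
        have : j = l := by
          by_contra hne
          exact hi (by simp [stdB, hne])
        rw [this]
      · exfalso
        apply hi
        rw [hzy]
        have : y ⟨2 * j + 1, by omega⟩ = 0 := by
          rcases hy with hy | ⟨l, hl, rfl⟩
          · exact hy _ (by have := j.2; simp only; omega)
          · have : 2 * (j : ℕ) + 1 ≠ 2 * l := by omega
            simp [stdA, this]
        simp [qcast, this]
    choose σ hσ using hσ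
    have hσinj : Function.Injective σ := by
      intro i j hij
      have h := (hσ i).symm.trans ((congrArg z hij).trans (hσ j))
      by_contra hne
      have hig : (i : ℕ) < g := by have := i.2; omega
      have := congrFun h ⟨2 * i + 1, by omega⟩
      simp [stdB, Fin.val_inj, hne] at this
    have hkn : k - 1 ≤ n := by simpa using Fintype.card_le_of_injective σ hσinj
    have hzint : ∀ i, ∃ y : Fin (2 * g) → ℤ, z i = qcast y := by
      intro i
      rcases hBdesc (z i) (hzB i) with ⟨l, -, hl⟩ | ⟨y, -, -, hy⟩
      · exact ⟨stdB ℤ g l, by rw [hl, qcast_stdB]⟩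
      · exact ⟨y, hy⟩
    choose y hy using hzint
    have hzy : ∀ v i, symp (qcast v) (z i) = 0 ↔ symp v (y i) = 0 := by
      intro v i
      rw [hy, symp_qcast, Int.cast_eq_zero]
    have hyx : ∀ i, symp x (y i) = 0 := by
      intro i
      have : z i ∈ perp {qcast x, qcast x'} := hBspan ▸ Submodule.subset_span (hzB i)
      have h := this (qcast x) (by simp)
      rwa [symp_eq_zero_comm, hzy] at h
    let S : Finset (Fin n) := (Finset.univ.image σ)ᶜ
    have hScard : Fintype.card S = n - (k - 1) := by
      rw [Fintype.card_coe, Finset.card_compl, Finset.card_image_of_injective _ hσinj]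
      simp
    have hort : ∀ v ∈ coordZero ℤ (2 * g) (2 * k), (∀ i : S, symp v (y i) = 0) →
        ∀ i, symp v (y i) = 0 := by
      intro v hv hvS i
      by_cases hi : i ∈ S
      · exact hvS ⟨i, hi⟩
      · obtain ⟨j, rfl⟩ : ∃ j, σ j = i := by simpa [S] using hi
        have hjg : (j : ℕ) < g := by have := j.2; omega
        rw [← hzy, hσ, symp_stdB hjg]
        simp only [qcast, Int.cast_eq_zero]
        exact hv _ (by have := j.2; simp only; omega)
    obtain ⟨j₀, hj₀, hxj₀⟩ : ∃ j : Fin (2 * g), (j : ℕ) < 2 * k ∧ x j ≠ 0 := by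
      by_contra! hh
      exact hxnot (.inl hh)
    have hshadow : ∀ w, Vtx w → ∃ a ∈ coordZero ℤ (2 * g) (2 * k), (∀ i, symp a (y i) = 0) ∧
        symp a x = 0 ∧ ∀ v ∈ coordZero ℤ (2 * g) (2 * k), symp v a = 0 →
          (∀ p : ℕ, p.Prime → v ∉ modSpan p {a}) →
          (∀ p : ℕ, p.Prime → (p : ℤ) ∣ x j₀ → v ∉ modSpan p {a, x}) →
          symp w v = 0 ∧ IsUnimodular ![x, w, v] := by
      rintro w ⟨-, hw, hwz, hxw, hwu⟩
      by_cases hwk : w ∈ coordZero ℤ (2 * g) (2 * k)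
      · exact ⟨w, hwk, fun i => (hzy w i).1 (hwz i), symp_eq_zero_comm.1 hxw,
          fun v hv hvw hline hplane => ⟨symp_eq_zero_comm.1 hvw,
            isUnimodular_three_of_forall_notMem_modSpan hj₀ hwu hwk hv hline hplane⟩⟩
      · obtain ⟨i, hi4, rfl⟩ := hw.resolve_left hwk
        have hig : i < g := by omega
        obtain rfl : i = k - 1 := by
          rcases lt_trichotomy i (k - 1) with h | h | h
          · obtain ⟨l, hl⟩ := hA i h
            exact absurd (hwz l) hl
          · exact h
          · refine absurd (fun j hj => ?_) hwk
            have : (j : ℕ) ≠ 2 * i := by omega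
            simp [stdA, this]
        have hxb : x ⟨2 * (k - 1) + 1, by omega⟩ = 0 := by
          rw [← symp_stdA hig x, symp_eq_zero_comm, hxw]
        set j₁ : Fin (2 * g) := ⟨2 * (k - 1), by omega⟩ with hj₁
        have hsub : ∀ b, symp x b = 0 → symp (stdA ℤ g (k - 1)) b = 0 →
            symp (x - x j₁ • stdA ℤ g (k - 1)) b = 0 := by
          intro b h1 h2
          rw [sub_eq_add_neg, ← neg_smul, symp_add_left, symp_smul_left, h1, h2]
          simp
        refine ⟨x - x j₁ • stdA ℤ g (k - 1), fun j hj => ?_,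
          fun i => hsub _ (hyx i) ((hzy _ i).1 (hwz i)),
          hsub _ (symp_self x) (symp_eq_zero_comm.1 hxw), fun v hv hva hline _ => ⟨?_, ?_⟩⟩
        · rcases lt_trichotomy (j : ℕ) (2 * (k - 1)) with h | h | h
          · simp [stdA, hxH j h, h.ne]
          · obtain rfl : j = j₁ := Fin.ext h
            simp [stdA, hj₁]
          · have hxj : x j = 0 := by
              rw [← hxb]
              exact congrArg x (Fin.ext (by simp only; omega))
            simp [stdA, hxj, h.ne']
        · rw [symp_stdA hig]
          exact hv _ (by simp only; omega)
        · exact isUnimodular_three_of_forall_notMem_modSpan_sub (by simp [stdA, hj₁])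
            (hv _ (by simp only [hj₁]; omega)) hwu hline
    obtain ⟨a, ha, hay, hax, had⟩ := hshadow w hw
    obtain ⟨a', ha', hay', hax', had'⟩ := hshadow w' hw'
    have hj₀g := j₀.2
    obtain ⟨v, hv, hvy, hvx, hva, hva', hvp⟩ :=
      exists_orthogonal_forall_notMem_modSpan (m := 2 * k) (ι := S)
        (by rw [hScard]; omega) (fun i => y i) x a a' hxj₀
        ha (fun i => hay i) hax ha' (fun i => hay' i) hax'
    obtain ⟨h1, h2⟩ := had v hv hva (fun p hp => (hvp p hp).1.1) (fun p hp h => ((hvp p hp).2 h).1)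
    obtain ⟨h1', h2'⟩ := had' v hv hva' (fun p hp => (hvp p hp).1.2)
      (fun p hp h => ((hvp p hp).2 h).2)
    have hxv : IsUnimodular ![x, v] := isUnimodular_pair_of_three (isUnimodular_swap h2)
    have hVv : Vtx v := ⟨isUnimodular_right_of_pair hxv, .inl hv,
      fun i => (hzy v i).2 (hort v hv hvy i), symp_eq_zero_comm.1 hvx, hxv⟩
    exact (Relation.ReflTransGen.single ⟨hw, hVv, h1, h2⟩).tail (hEsymm _ _ ⟨hw', hVv, h1', h2'⟩)

end Paper
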